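/- arXiv:2203.07513 — 2 statements merged into one kernel-verified Lean document; each statement's English description precedes it below -/
import Mathlib

section
/- Consider a k-stage screening process with minimally effective tests and let π be any Equal Opportunity policy with recall(π) > 0. Then there exists an Equal Opportunity policy π' with recall(π') ≥ recall(π) and precision(π') ≥ precision(π) such that for each group X ∈ 𝒳 there is at most one stage i at which π' partially uses the test — i.e., at most one i with either (0 < π'^i_{X1} < 1 and π'^i_{X0} = 0) or (π'^i_{X1} = 1 and 0 < π'^i_{X0} < 1) — and at every other stage j, π' either bypasses the test (π'^j_{X1} = π'^j_{X0} = 1) or fully exploits it (π'^j_{X1} = 1, π'^j_{X0} = 0). -/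
open Finset

/-- Promotion probability of a positive example: `M(τ,π) = τ₁π₁ + (1−τ₁)π₀`. -/
noncomputable def Mval (t p : ℝ × ℝ) : ℝ := t.1 * p.1 + (1 - t.1) * p.2

/-- Promotion probability of a negative example: `N(τ,π) = τ₀π₁ + (1−τ₀)π₀`. -/
noncomputable def Nval (t p : ℝ × ℝ) : ℝ := t.2 * p.1 + (1 - t.2) * p.2

/-- True positive rate of group `x` through a `k`-stage pipeline. -/
noncomputable def MX {𝒳 : Type*} {k : ℕ} (τ π : 𝒳 → Fin k → ℝ × ℝ) (x : 𝒳) : ℝ :=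
  ∏ i, Mval (τ x i) (π x i)

/-- False positive rate of group `x` through a `k`-stage pipeline. -/
noncomputable def NX {𝒳 : Type*} {k : ℕ} (τ π : 𝒳 → Fin k → ℝ × ℝ) (x : 𝒳) : ℝ :=
  ∏ i, Nval (τ x i) (π x i)

/-- Precision (interview efficiency) of a policy. -/
noncomputable def prec {𝒳 : Type*} [Fintype 𝒳] {k : ℕ} (q u : 𝒳 → ℝ)
    (τ π : 𝒳 → Fin k → ℝ × ℝ) : ℝ :=
  (∑ x, q x * MX τ π x) / ((∑ x, q x * MX τ π x) + ∑ x, u x * NX τ π x)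

/-- A policy has all its entries in `[0,1]`. -/
def IsPolicy {𝒳 : Type*} {k : ℕ} (π : 𝒳 → Fin k → ℝ × ℝ) : Prop :=
  ∀ x i, (π x i).1 ∈ Set.Icc (0:ℝ) 1 ∧ (π x i).2 ∈ Set.Icc (0:ℝ) 1

/-- All tests are minimally effective: `τ₁ > τ₀ ≥ 0` (and lie in `[0,1]²`). -/
def MinEff {𝒳 : Type*} {k : ℕ} (τ : 𝒳 → Fin k → ℝ × ℝ) : Prop :=
  ∀ x i, (τ x i).2 < (τ x i).1 ∧ 0 ≤ (τ x i).2 ∧ (τ x i).1 ≤ 1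

/-- `π` partially uses the test of group `x` at stage `i`:
either `0 < π^i_{x1} < 1` and `π^i_{x0} = 0`, or `π^i_{x1} = 1` and `0 < π^i_{x0} < 1`. -/
def PartialUse {𝒳 : Type*} {k : ℕ} (π : 𝒳 → Fin k → ℝ × ℝ) (x : 𝒳) (i : Fin k) : Prop :=
  (0 < (π x i).1 ∧ (π x i).1 < 1 ∧ (π x i).2 = 0) ∨
  ((π x i).1 = 1 ∧ 0 < (π x i).2 ∧ (π x i).2 < 1)

/-- A single test is minimally effective. -/
def Effective (t : ℝ × ℝ) : Prop := t.2 < t.1 ∧ 0 ≤ t.2 ∧ t.1 ≤ 1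

/-- Single-stage policies that never promote a failing example unless all passing ones are
promoted, and that promote something. -/
def Canonical (p : ℝ × ℝ) : Prop :=
  (0 < p.1 ∧ p.1 ≤ 1 ∧ p.2 = 0) ∨ (p.1 = 1 ∧ 0 ≤ p.2 ∧ p.2 ≤ 1)

/-- The single-stage policies that bypass or fully exploit the test. -/
def Extreme (p : ℝ × ℝ) : Prop := (p.1 = 1 ∧ p.2 = 1) ∨ (p.1 = 1 ∧ p.2 = 0)

lemma Extreme.canonical {p : ℝ × ℝ} (h : Extreme p) : Canonical p := by
  rcases h with ⟨h1, h2⟩ | ⟨h1, h2⟩ <;> right <;> simp [h1, h2]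

lemma Canonical.mem_Icc {p : ℝ × ℝ} (h : Canonical p) :
    p.1 ∈ Set.Icc (0:ℝ) 1 ∧ p.2 ∈ Set.Icc (0:ℝ) 1 := by
  rcases h with ⟨h1, h2, h3⟩ | ⟨h1, h2, h3⟩
  · exact ⟨⟨h1.le, h2⟩, by simp [h3]⟩
  · exact ⟨by simp [h1], h2, h3⟩

lemma Canonical.extreme_or_partial {p : ℝ × ℝ} (h : Canonical p) :
    Extreme p ∨ (0 < p.1 ∧ p.1 < 1 ∧ p.2 = 0) ∨ (p.1 = 1 ∧ 0 < p.2 ∧ p.2 < 1) := by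
  unfold Extreme
  rcases h with ⟨h1, h2, h3⟩ | ⟨h1, h2, h3⟩
  · rcases h2.lt_or_eq with h | h <;> tauto
  · rcases h2.lt_or_eq with h | h <;> rcases h3.lt_or_eq with h' | h' <;> tauto

lemma Mval_nonneg {t p : ℝ × ℝ} (ht : Effective t)
    (hp : p.1 ∈ Set.Icc (0:ℝ) 1 ∧ p.2 ∈ Set.Icc (0:ℝ) 1) : 0 ≤ Mval t p := by
  obtain ⟨h1, h2, h3⟩ := ht
  have := mul_nonneg (h2.trans h1.le) hp.1.1
  have := mul_nonneg (sub_nonneg.2 h3) hp.2.1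
  unfold Mval
  linarith

lemma Nval_nonneg {t p : ℝ × ℝ} (ht : Effective t)
    (hp : p.1 ∈ Set.Icc (0:ℝ) 1 ∧ p.2 ∈ Set.Icc (0:ℝ) 1) : 0 ≤ Nval t p := by
  obtain ⟨h1, h2, h3⟩ := ht
  have := mul_nonneg h2 hp.1.1
  have := mul_nonneg (sub_nonneg.2 (h1.le.trans h3)) hp.2.1
  unfold Nval
  linarith

lemma Mval_pos {t p : ℝ × ℝ} (ht : Effective t) (hp : Canonical p) : 0 < Mval t p := by
  obtain ⟨h1, h2, h3⟩ := ht
  have h4 : 0 < t.1 := h2.trans_lt h1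
  unfold Mval
  rcases hp with ⟨a, b, c⟩ | ⟨a, b, c⟩
  · rw [c]; nlinarith [mul_pos h4 a]
  · rw [a]; nlinarith [mul_nonneg (sub_nonneg.2 h3) b]

lemma exists_canonical {t p : ℝ × ℝ} (ht : Effective t)
    (hp : p.1 ∈ Set.Icc (0:ℝ) 1 ∧ p.2 ∈ Set.Icc (0:ℝ) 1) (hM : 0 < Mval t p) :
    ∃ p', Canonical p' ∧ Mval t p' = Mval t p ∧ Nval t p' ≤ Nval t p := by
  obtain ⟨h1, h2, h3⟩ := ht
  obtain ⟨⟨p1, p1'⟩, p2, p2'⟩ := hp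
  have h4 : 0 < t.1 := h2.trans_lt h1
  have hle : Mval t p ≤ 1 := by
    unfold Mval
    nlinarith [mul_nonneg h4.le (sub_nonneg.2 p1'),
      mul_nonneg (sub_nonneg.2 h3) (sub_nonneg.2 p2')]
  rcases le_or_gt (Mval t p) t.1 with h | h
  · refine ⟨(Mval t p / t.1, 0), Or.inl ⟨by positivity, (div_le_one h4).2 h, rfl⟩, ?_, ?_⟩
    · rw [Mval]; field_simp; ring
    · have : t.2 * (Mval t p / t.1) ≤ Nval t p := by
        rw [← mul_div_assoc, div_le_iff₀ h4, Mval, Nval]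
        nlinarith [mul_nonneg (sub_nonneg.2 h1.le) p2]
      rw [Nval]; linarith
  · have h5 : 0 < 1 - t.1 := by linarith
    refine ⟨(1, (Mval t p - t.1) / (1 - t.1)),
      Or.inr ⟨rfl, div_nonneg (by linarith) h5.le, (div_le_one h5).2 (by linarith)⟩, ?_, ?_⟩
    · rw [Mval]; field_simp; ring
    · have : (1 - t.2) * ((Mval t p - t.1) / (1 - t.1)) ≤ Nval t p - t.2 := by
        rw [← mul_div_assoc, div_le_iff₀ h5, Mval, Nval]
        nlinarith [mul_nonneg (sub_nonneg.2 h1.le) (sub_nonneg.2 p1')]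
      rw [Nval]; linarith

/-- The pair of stages `(s, p)`, `(t, p')` can be replaced by one with an extreme stage. -/
def Improvable (s t p p' : ℝ × ℝ) : Prop :=
  ∃ a b, Canonical a ∧ Canonical b ∧ (Extreme a ∨ Extreme b) ∧
    Mval s a * Mval t b = Mval s p * Mval t p' ∧
    Nval s a * Nval t b ≤ Nval s p * Nval t p'

lemma Improvable.symm {s t p p' : ℝ × ℝ} (h : Improvable s t p p') : Improvable t s p' p := by
  obtain ⟨a, b, ha, hb, hab, hM, hN⟩ := h
  exact ⟨b, a, hb, ha, hab.symm, by linarith, by linarith⟩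

lemma improvable_of_snd_eq_zero {s t p p' : ℝ × ℝ} (hs : Effective s) (ht : Effective t)
    (hp : 0 < p.1 ∧ p.1 ≤ 1 ∧ p.2 = 0) (hp' : Canonical p') : Improvable s t p p' := by
  have hM : Mval t (p.1 * p'.1, p.1 * p'.2) = p.1 * Mval t p' := by unfold Mval; ring
  have hN : Nval t (p.1 * p'.1, p.1 * p'.2) = p.1 * Nval t p' := by unfold Nval; ring
  obtain ⟨⟨a1, a2⟩, a3, a4⟩ := hp'.mem_Icc
  obtain ⟨b, hb, hbM, hbN⟩ := exists_canonical (p := (p.1 * p'.1, p.1 * p'.2)) ht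
    ⟨⟨mul_nonneg hp.1.le a1, mul_le_one₀ hp.2.1 a1 a2⟩,
      mul_nonneg hp.1.le a3, mul_le_one₀ hp.2.1 a3 a4⟩
    (by rw [hM]; exact mul_pos hp.1 (Mval_pos ht hp'))
  have hE : Extreme (1, 0) := Or.inr ⟨rfl, rfl⟩
  refine ⟨(1, 0), b, hE.canonical, hb, Or.inl hE, ?_, ?_⟩
  · rw [hbM, hM]; simp only [Mval, hp.2.2]; ring
  · rw [hN] at hbN
    calc Nval s (1, 0) * Nval t b ≤ Nval s (1, 0) * (p.1 * Nval t p') :=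
          mul_le_mul_of_nonneg_left hbN (Nval_nonneg hs hE.canonical.mem_Icc)
      _ = Nval s p * Nval t p' := by simp only [Nval, hp.2.2]; ring

/-- The false positive rate of `(1, b)` as an affine function of its true positive rate. -/
lemma Nval_eq_of_fst_eq_one {t p : ℝ × ℝ} (h : t.1 < 1) (hp : p.1 = 1) :
    Nval t p = Mval t p + (t.1 - t.2) / (1 - t.1) * (Mval t p - 1) := by
  have : 1 - t.1 ≠ 0 := by linarith
  rw [Nval, Mval, hp]
  field_simp
  ring

/-- The policy promoting all passing examples and having true positive rate `m`. -/
lemma exists_fst_eq_one {t : ℝ × ℝ} (h : t.1 < 1) {m : ℝ} (hm : t.1 ≤ m) (hm' : m ≤ 1) :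
    ∃ p : ℝ × ℝ, p.1 = 1 ∧ Canonical p ∧ Mval t p = m ∧ (m = t.1 ∨ m = 1 → Extreme p) := by
  have h5 : 0 < 1 - t.1 := by linarith
  refine ⟨(1, (m - t.1) / (1 - t.1)), rfl,
    Or.inr ⟨rfl, div_nonneg (by linarith) h5.le, (div_le_one h5).2 (by linarith)⟩, ?_, ?_⟩
  · rw [Mval]; field_simp; ring
  · rintro (rfl | rfl)
    · exact Or.inr ⟨rfl, by simp⟩
    · exact Or.inl ⟨rfl, by simp [h5.ne']⟩

/-- Lowering `m` while keeping `m * n` fixed does not increase the product of the affine functions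
of slopes `1 + A` and `1 + B` that take the value `1` at `1`, provided the product does not
increase to first order. -/
lemma mul_affine_le {A B m n m' n' : ℝ} (hA : 0 ≤ A) (hB : 0 ≤ B)
    (hm' : 0 < m') (hmm : m' ≤ m) (hn : 0 < n) (h : m' * n' = m * n)
    (hAB : (1 + A) * B * m ≤ (1 + B) * A * n) :
    (m' + A * (m' - 1)) * (n' + B * (n' - 1)) ≤ (m + A * (m - 1)) * (n + B * (n - 1)) := by
  have hd : m' * (n' - n) = (m - m') * n := by linarith
  have hnn : n ≤ n' := by
    by_contra hc
    nlinarith [mul_pos hm' (sub_pos.2 (not_le.1 hc)), mul_nonneg (sub_nonneg.2 hmm) hn.le]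
  have key : (1 + A) * B * (m - m') ≤ (1 + B) * A * (n' - n) := by
    have h1 : m' * ((1 + A) * B * (m - m')) ≤ m' * ((1 + B) * A * (n' - n)) := by
      calc m' * ((1 + A) * B * (m - m')) ≤ m * ((1 + A) * B * (m - m')) := by
            apply mul_le_mul_of_nonneg_right hmm
            have := sub_nonneg.2 hmm
            positivity
        _ = (m - m') * ((1 + A) * B * m) := by ring
        _ ≤ (m - m') * ((1 + B) * A * n) :=
            mul_le_mul_of_nonneg_left hAB (sub_nonneg.2 hmm)
        _ = (1 + B) * A * ((m - m') * n) := by ring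
        _ = m' * ((1 + B) * A * (n' - n)) := by rw [← hd]; ring
    exact le_of_mul_le_mul_left h1 hm'
  have e : (m + A * (m - 1)) * (n + B * (n - 1)) - (m' + A * (m' - 1)) * (n' + B * (n' - 1))
      = (1 + A) * (1 + B) * (m * n - m' * n')
        + ((1 + B) * A * (n' - n) - (1 + A) * B * (m - m')) := by ring
  rw [h] at e
  linarith

lemma improvable_of_fst_eq_one_of_slope {s t p p' : ℝ × ℝ} (hs : Effective s) (ht : Effective t)
    (hs1 : s.1 < 1) (ht1 : t.1 < 1) (hp : p.1 = 1) (hp' : p'.1 = 1)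
    (hc : Canonical p) (hc' : Canonical p')
    (hAB : (1 + (s.1 - s.2) / (1 - s.1)) * ((t.1 - t.2) / (1 - t.1)) * Mval s p ≤
      (1 + (t.1 - t.2) / (1 - t.1)) * ((s.1 - s.2) / (1 - s.1)) * Mval t p') :
    Improvable s t p p' := by
  have hA : 0 ≤ (s.1 - s.2) / (1 - s.1) := div_nonneg (by linarith [hs.1]) (by linarith)
  have hB : 0 ≤ (t.1 - t.2) / (1 - t.1) := div_nonneg (by linarith [ht.1]) (by linarith)
  have hs0 : 0 < s.1 := hs.2.1.trans_lt hs.1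
  have lower : ∀ {t p : ℝ × ℝ}, t.1 < 1 → p.1 = 1 → Canonical p →
      t.1 ≤ Mval t p ∧ Mval t p ≤ 1 := by
    intro t p h1 h2 h3
    obtain ⟨-, h4, h5⟩ := h3.mem_Icc
    rw [Mval, h2]
    constructor
    · nlinarith [mul_nonneg (sub_nonneg.2 h1.le) h4]
    · nlinarith [mul_nonneg (sub_nonneg.2 h1.le) (sub_nonneg.2 h5)]
  obtain ⟨m1, m2⟩ := lower hs1 hp hc
  obtain ⟨n1, n2⟩ := lower ht1 hp' hc'
  have hm := Mval_pos hs hc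
  have hn := Mval_pos ht hc'
  suffices ∃ m' n', s.1 ≤ m' ∧ m' ≤ Mval s p ∧ t.1 ≤ n' ∧ n' ≤ 1 ∧
      m' * n' = Mval s p * Mval t p' ∧ (m' = s.1 ∨ n' = 1) by
    obtain ⟨m', n', a1, a2, b1, b2, hmn, hE⟩ := this
    obtain ⟨a, ha1, ha, haM, haE⟩ := exists_fst_eq_one hs1 a1 (a2.trans m2)
    obtain ⟨b, hb1, hb, hbM, hbE⟩ := exists_fst_eq_one ht1 b1 b2
    refine ⟨a, b, ha, hb, hE.imp (fun h => haE (Or.inl h)) (fun h => hbE (Or.inr h)),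
      by rw [haM, hbM, hmn], ?_⟩
    rw [Nval_eq_of_fst_eq_one hs1 ha1, Nval_eq_of_fst_eq_one ht1 hb1,
      Nval_eq_of_fst_eq_one hs1 hp, Nval_eq_of_fst_eq_one ht1 hp', haM, hbM]
    exact mul_affine_le hA hB (hs0.trans_le a1) a2 hn hmn hAB
  rcases le_total s.1 (Mval s p * Mval t p') with h | h
  · exact ⟨_, 1, h, mul_le_of_le_one_right hm.le n2, ht1.le, le_rfl, mul_one _, Or.inr rfl⟩
  · refine ⟨s.1, Mval s p * Mval t p' / s.1, le_rfl, m1, ?_, (div_le_one hs0).2 h,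
      by field_simp, Or.inl rfl⟩
    rw [le_div_iff₀ hs0]
    nlinarith [mul_le_mul n1 m1 hs0.le hn.le]

lemma improvable_of_canonical {s t p p' : ℝ × ℝ} (hs : Effective s) (ht : Effective t)
    (hp : Canonical p) (hp' : Canonical p') : Improvable s t p p' := by
  rcases id hp with h | h
  · exact improvable_of_snd_eq_zero hs ht h hp'
  rcases id hp' with h' | h'
  · exact (improvable_of_snd_eq_zero ht hs h' hp).symm
  have top : ∀ {t p : ℝ × ℝ}, t.1 = 1 → p.1 = 1 → Effective t → Canonical p →
      Mval t (1, 0) = Mval t p ∧ Nval t (1, 0) ≤ Nval t p := by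
    intro t p h1 h2 h3 h4
    simp only [Mval, Nval, h1, h2]
    have := mul_nonneg (sub_nonneg.2 (h3.1.le.trans h3.2.2)) h4.mem_Icc.2.1
    constructor <;> linarith
  have hE : Extreme (1, 0) := Or.inr ⟨rfl, rfl⟩
  rcases hs.2.2.lt_or_eq with hs1 | hs1
  swap
  · obtain ⟨e1, e2⟩ := top hs1 h.1 hs hp
    exact ⟨(1, 0), p', hE.canonical, hp', Or.inl hE, by rw [e1],
      mul_le_mul_of_nonneg_right e2 (Nval_nonneg ht hp'.mem_Icc)⟩
  rcases ht.2.2.lt_or_eq with ht1 | ht1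
  swap
  · obtain ⟨e1, e2⟩ := top ht1 h'.1 ht hp'
    exact ⟨p, (1, 0), hp, hE.canonical, Or.inr hE, by rw [e1],
      mul_le_mul_of_nonneg_left e2 (Nval_nonneg hs hp.mem_Icc)⟩
  rcases le_total ((1 + (s.1 - s.2) / (1 - s.1)) * ((t.1 - t.2) / (1 - t.1)) * Mval s p)
    ((1 + (t.1 - t.2) / (1 - t.1)) * ((s.1 - s.2) / (1 - s.1)) * Mval t p') with hAB | hAB
  · exact improvable_of_fst_eq_one_of_slope hs ht hs1 ht1 h.1 h'.1 hp hp' hAB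
  · exact (improvable_of_fst_eq_one_of_slope ht hs ht1 hs1 h'.1 h.1 hp' hp hAB).symm

/-- Within one group, stages can be made extreme except for at most one. -/
lemma exists_canonical_subsingleton {ι : Type*} [DecidableEq ι] (S : Finset ι) (t p : ι → ℝ × ℝ)
    (ht : ∀ i, Effective (t i)) (hp : ∀ i, Canonical (p i)) :
    ∃ p' : ι → ℝ × ℝ, (∀ i, Canonical (p' i)) ∧
      (∏ i ∈ S, Mval (t i) (p' i) = ∏ i ∈ S, Mval (t i) (p i)) ∧
      (∏ i ∈ S, Nval (t i) (p' i) ≤ ∏ i ∈ S, Nval (t i) (p i)) ∧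
      ∀ i ∈ S, ∀ j ∈ S, ¬ Extreme (p' i) → ¬ Extreme (p' j) → i = j := by
  classical
  induction S using Finset.induction_on with
  | empty => exact ⟨p, hp, by simp⟩
  | insert a S ha ih =>
    obtain ⟨r, hr, hM, hN, hS⟩ := ih
    have hN' := mul_le_mul_of_nonneg_left hN (Nval_nonneg (ht a) (hp a).mem_Icc)
    by_cases hex : ∃ j ∈ S, ¬ Extreme (r j)
    · obtain ⟨j, hj, hjE⟩ := hex
      obtain ⟨b, c, hb, hc, hE, hbcM, hbcN⟩ := improvable_of_canonical (ht a) (ht j) (hp a) (hr j)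
      have haj : j ≠ a := fun h => ha (h ▸ hj)
      have split : ∀ f : ℝ × ℝ → ℝ × ℝ → ℝ, ∏ i ∈ insert a S,
          f (t i) (Function.update (Function.update r j c) a b i) =
          f (t a) b * f (t j) c * ∏ i ∈ S.erase j, f (t i) (r i) := by
        intro f
        rw [prod_insert ha, ← mul_prod_erase S _ hj, mul_assoc]
        simp only [Function.update_self, Function.update_of_ne haj]
        congr 2
        refine prod_congr rfl fun i hi => ?_
        obtain ⟨hij, hiS⟩ := mem_erase.1 hi
        rw [Function.update_of_ne (ne_of_mem_of_not_mem hiS ha), Function.update_of_ne hij]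
      refine ⟨Function.update (Function.update r j c) a b, ?_, ?_, ?_, ?_⟩
      · intro i
        by_cases hi : i = a
        · subst hi; simpa using hb
        by_cases hij : i = j
        · subst hij; simpa [hi] using hc
        simpa [hi, hij] using hr i
      · rw [split Mval, hbcM, prod_insert ha, ← hM, ← mul_prod_erase S _ hj, mul_assoc]
      · rw [split Nval, prod_insert ha]
        refine le_trans ?_ hN'
        rw [← mul_prod_erase S _ hj, ← mul_assoc]
        exact mul_le_mul_of_nonneg_right hbcN
          (prod_nonneg fun i _ => Nval_nonneg (ht i) (hr i).mem_Icc)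
      · have hsub : ∀ i ∈ insert a S,
            ¬ Extreme (Function.update (Function.update r j c) a b i) →
            (i = a ∧ ¬ Extreme b) ∨ (i = j ∧ ¬ Extreme c) := by
          intro i hi h
          by_cases hia : i = a
          · subst hia; left; simpa using h
          right
          by_cases hij : i = j
          · subst hij; simpa [hia] using h
          rw [Function.update_of_ne hia, Function.update_of_ne hij] at h
          exact absurd (hS i ((mem_insert.1 hi).resolve_left hia) j hj h hjE) hij
        intro i hi i' hi' h h'
        have h1 := hsub i hi h
        have h2 := hsub i' hi' h'
        grind
    · push Not at hex
      have hne : ∀ i ∈ S, Function.update r a (p a) i = r i := fun i hi =>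
        Function.update_of_ne (ne_of_mem_of_not_mem hi ha) _ _
      have split : ∀ f : ℝ × ℝ → ℝ × ℝ → ℝ, ∏ i ∈ insert a S,
          f (t i) (Function.update r a (p a) i) = f (t a) (p a) * ∏ i ∈ S, f (t i) (r i) := by
        intro f
        rw [prod_insert ha, Function.update_self]
        congr 1
        exact prod_congr rfl fun i hi => by rw [hne i hi]
      refine ⟨Function.update r a (p a), ?_, ?_, ?_, ?_⟩
      · intro i
        by_cases hi : i = a
        · subst hi; simpa using hp i
        simpa [hi] using hr i
      · rw [split Mval, prod_insert ha, hM]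
      · rw [split Nval, prod_insert ha]
        exact hN'
      · have hsub : ∀ i ∈ insert a S, ¬ Extreme (Function.update r a (p a) i) → i = a := by
          intro i hi h
          rcases mem_insert.1 hi with h' | h'
          · exact h'
          · exact absurd (hex i h') (hne i h' ▸ h)
        exact fun i hi j hj h h' => (hsub i hi h).trans (hsub j hj h').symm

/-- Every Equal Opportunity policy with positive recall is weakly Pareto dominated by an
Equal Opportunity policy that, for each group, partially uses at most one test and at every
other stage either bypasses the test or fully exploits it. -/
theorem stmt11 {𝒳 : Type*} [Fintype 𝒳] [Nonempty 𝒳] {k : ℕ}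
    (q u : 𝒳 → ℝ) (τ : 𝒳 → Fin k → ℝ × ℝ)
    (hq : ∀ x, 0 < q x) (hu : ∀ x, 0 < u x) (hτ : MinEff τ)
    (π : 𝒳 → Fin k → ℝ × ℝ) (hπ : IsPolicy π)
    (r : ℝ) (hEO : ∀ x, MX τ π x = r) (hr : 0 < r) :
    ∃ (π' : 𝒳 → Fin k → ℝ × ℝ) (r' : ℝ), IsPolicy π' ∧ (∀ x, MX τ π' x = r') ∧
      (∀ x i j, PartialUse π' x i → PartialUse π' x j → i = j) ∧
      (∀ x i, ¬ PartialUse π' x i →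
        ((π' x i).1 = 1 ∧ (π' x i).2 = 1) ∨ ((π' x i).1 = 1 ∧ (π' x i).2 = 0)) ∧
      r ≤ r' ∧ prec q u τ π ≤ prec q u τ π' := by
  have hM0 : ∀ x i, 0 < Mval (τ x i) (π x i) := by
    intro x i
    refine (Mval_nonneg (hτ x i) (hπ x i)).lt_of_ne' fun h => hr.ne' ?_
    rw [← hEO x]
    exact prod_eq_zero (mem_univ i) h
  choose p hp hpM hpN using fun x i => exists_canonical (hτ x i) (hπ x i) (hM0 x i)
  choose π' hc hM hN hE using fun x =>
    exists_canonical_subsingleton univ (τ x) (p x) (hτ x) (hp x)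
  have hMX : ∀ x, MX τ π' x = MX τ π x := fun x =>
    (hM x).trans (prod_congr rfl fun i _ => hpM x i)
  have hNX : ∀ x, NX τ π' x ≤ NX τ π x := fun x =>
    (hN x).trans (prod_le_prod (fun i _ => Nval_nonneg (hτ x i) (hp x i).mem_Icc)
      fun i _ => hpN x i)
  have hNX0 : ∀ x, 0 ≤ NX τ π' x := fun x =>
    prod_nonneg fun i _ => Nval_nonneg (hτ x i) (hc x i).mem_Icc
  have not_extreme : ∀ x i, PartialUse π' x i → ¬ Extreme (π' x i) := by
    rintro x i (⟨h1, h2, h3⟩ | ⟨h1, h2, h3⟩) (⟨h4, h5⟩ | ⟨h4, h5⟩) <;> linarith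
  refine ⟨π', r, fun x i => (hc x i).mem_Icc, fun x => (hMX x).trans (hEO x), ?_, ?_, le_rfl, ?_⟩
  · exact fun x i j hi hj => hE x i (mem_univ i) j (mem_univ j)
      (not_extreme x i hi) (not_extreme x j hj)
  · exact fun x i h => (hc x i).extreme_or_partial.resolve_right h
  · unfold prec
    simp only [hMX, hEO]
    have hpos : 0 < ∑ x, q x * r := sum_pos (fun x _ => mul_pos (hq x) hr) univ_nonempty
    refine div_le_div_of_nonneg_left hpos.le ?_ ?_
    · exact add_pos_of_pos_of_nonneg hpos
        (sum_nonneg fun x _ => mul_nonneg (hu x).le (hNX0 x))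
    · gcongr with x
      · exact (hu x).le
      · exact hNX x
end

section
/- Consider a k-stage screening process with minimally effective tests and let ρ = max_{X∈𝒳} ∏_{i=1}^k (τ^i_{X0}/τ^i_{X1}). Then every policy π satisfying Equalized Odds (M_X(π) and N_X(π) each constant over X ∈ 𝒳) whose precision denominator is positive has precision(π) ≤ ‖q‖₁ / (‖q‖₁ + ρ·Σ_{X∈𝒳} u_X). -/
open Finset

theorem Mval_nonneg_s13 {t p : ℝ × ℝ} (h₀ : 0 ≤ t.1) (h₁ : t.1 ≤ 1) (hp₁ : 0 ≤ p.1)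
    (hp₀ : 0 ≤ p.2) : 0 ≤ Mval t p :=
  add_nonneg (mul_nonneg h₀ hp₁) (mul_nonneg (sub_nonneg.2 h₁) hp₀)

/-- A single stage cannot lower the ratio of false to true positives below `τ₀/τ₁`. -/
theorem div_mul_Mval_le_Nval {t p : ℝ × ℝ} (h₀ : 0 < t.1) (h : t.2 ≤ t.1) (hp₀ : 0 ≤ p.2) :
    t.2 / t.1 * Mval t p ≤ Nval t p := by
  rw [div_mul_eq_mul_div, div_le_iff₀ h₀]
  unfold Mval Nval
  nlinarith [mul_nonneg hp₀ (sub_nonneg.2 h)]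

theorem prod_div_mul_MX_le_NX {𝒳 : Type*} {k : ℕ} {τ π : 𝒳 → Fin k → ℝ × ℝ}
    (hτ : MinEff τ) (hπ : IsPolicy π) (x : 𝒳) :
    (∏ i, (τ x i).2 / (τ x i).1) * MX τ π x ≤ NX τ π x := by
  unfold MX NX
  rw [← Finset.prod_mul_distrib]
  refine Finset.prod_le_prod (fun i _ => ?_) (fun i _ => ?_) <;>
    obtain ⟨hlt, h₀, h₁⟩ := hτ x i <;> have hpos := h₀.trans_lt hlt
  · exact mul_nonneg (div_nonneg h₀ hpos.le)
      (Mval_nonneg_s13 hpos.le h₁ (hπ x i).1.1 (hπ x i).2.1)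
  · exact div_mul_Mval_le_Nval hpos hlt.le (hπ x i).2.1

/-- With `ρ = max_X ∏_i (τ^i_{X0}/τ^i_{X1})`, every Equalized Odds policy of a `k`-stage
screening process with minimally effective tests has precision at most
`‖q‖₁ / (‖q‖₁ + ρ·Σ_X u_X)`. -/
theorem stmt13 {𝒳 : Type*} [Fintype 𝒳] [Nonempty 𝒳] {k : ℕ}
    (q u : 𝒳 → ℝ) (τ : 𝒳 → Fin k → ℝ × ℝ)
    (hq : ∀ x, 0 < q x) (hu : ∀ x, 0 < u x) (hτ : MinEff τ)
    (ρ : ℝ) (hρub : ∀ x, (∏ i, (τ x i).2 / (τ x i).1) ≤ ρ)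
    (hρmem : ∃ x, ρ = ∏ i, (τ x i).2 / (τ x i).1)
    (π : 𝒳 → Fin k → ℝ × ℝ) (hπ : IsPolicy π)
    (M N : ℝ) (hM : ∀ x, MX τ π x = M) (hN : ∀ x, NX τ π x = N)
    (hden : 0 < (∑ x, q x * MX τ π x) + ∑ x, u x * NX τ π x) :
    prec q u τ π ≤ (∑ x, q x) / ((∑ x, q x) + ρ * ∑ x, u x) := by
  obtain ⟨x₀, hx₀⟩ := hρmem
  have hMN : ρ * M ≤ N := by
    rw [hx₀, ← hM x₀, ← hN x₀]
    exact prod_div_mul_MX_le_NX hτ hπ x₀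
  have hρ : 0 ≤ ρ := hx₀ ▸ Finset.prod_nonneg fun i _ =>
    div_nonneg (hτ x₀ i).2.1 ((hτ x₀ i).2.1.trans (hτ x₀ i).1.le)
  have hQ : 0 < ∑ x, q x := Finset.sum_pos (fun x _ => hq x) Finset.univ_nonempty
  have hU : 0 < ∑ x, u x := Finset.sum_pos (fun x _ => hu x) Finset.univ_nonempty
  unfold prec
  simp only [hM, hN, ← Finset.sum_mul] at hden ⊢
  rw [div_le_div_iff₀ hden (by positivity)]
  linarith [mul_le_mul_of_nonneg_left hMN (mul_pos hQ hU).le]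
end
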